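/- arXiv:1411.6058 — 2 statements merged into one kernel-verified Lean document; each statement's English description precedes it below -/
import Mathlib

section
/- Let V be a finite-dimensional real normed vector space, let v : ℝ → (V →ₗ[ℝ] V) be a continuous family of linear endomorphisms, and let u : ℝ → (V →ₗ[ℝ] V) be a differentiable family of invertible linear maps satisfying the ODE u'(t) = -(1/2) · (v(t) ∘ u(t)) for all t. If A : V →ₗ[ℝ] V is an invertible linear map that commutes with v(t) for every t (i.e. v(t) ∘ A⁻¹ = A⁻¹ ∘ v(t)), then the map t ↦ u(t)⁻¹ ∘ A⁻¹ ∘ u(t) is constant in t. -/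
/-- Differentiation of a pointwise inverse in a complete normed algebra. -/
theorem HasDerivAt.of_mul_eq_one {R : Type*} [NormedRing R] [NormedAlgebra ℝ R] [CompleteSpace R]
    {u w : ℝ → R} {u' : R} {t : ℝ} (hwu : ∀ t, w t * u t = 1) (huw : ∀ t, u t * w t = 1)
    (hu : HasDerivAt u u' t) : HasDerivAt w (-(w t * u' * w t)) t := by
  have hw : Ring.inverse ∘ u = w := by
    funext s
    exact Ring.inverse_unit (⟨u s, w s, huw s, hwu s⟩ : Rˣ)
  have h := (hasFDerivAt_ringInverse (𝕜 := ℝ)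
    (⟨u t, w t, huw t, hwu t⟩ : Rˣ)).comp_hasDerivAt t hu
  rw [hw] at h
  simpa using h

/-- If `u' = c • (v * u)` and `b` commutes with every `v t`, then the conjugate `u⁻¹ * b * u` is
constant. -/
theorem conj_eq_of_hasDerivAt_smul_mul {R : Type*} [NormedRing R] [NormedAlgebra ℝ R]
    [CompleteSpace R] {u w v : ℝ → R} {b : R} (c : ℝ) (hwu : ∀ t, w t * u t = 1)
    (huw : ∀ t, u t * w t = 1) (hu : ∀ t, HasDerivAt u (c • (v t * u t)) t)
    (hb : ∀ t, Commute (v t) b) (s t : ℝ) : w t * (b * u t) = w s * (b * u s) := by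
  have hd : ∀ r, HasDerivAt (fun r => w r * (b * u r)) 0 r := by
    intro r
    have h : w r * (v r * u r) * w r * (b * u r) = w r * (b * (v r * u r)) := by
      calc w r * (v r * u r) * w r * (b * u r)
          = w r * (v r * (u r * w r)) * (b * u r) := by simp only [mul_assoc]
        _ = w r * ((v r * b) * u r) := by rw [huw, mul_one]; simp only [mul_assoc]
        _ = w r * (b * (v r * u r)) := by rw [(hb r).eq]; simp only [mul_assoc]
    have h0 : -(w r * (c • (v r * u r)) * w r) * (b * u r) + w r * (b * c • (v r * u r)) = 0 := by
      simp only [mul_smul_comm, smul_mul_assoc, neg_mul, h, neg_add_cancel]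
    exact h0 ▸ (HasDerivAt.of_mul_eq_one hwu huw (hu r)).mul ((hu r).const_mul b)
  exact is_const_of_deriv_eq_zero (fun r => (hd r).differentiableAt) (fun r => (hd r).deriv) t s

/-- The linear-algebra content of the Uhlenbeck trick: if `u t` solves
`u' = -(1/2) • (v t ∘ u t)`, each `u t` is invertible (with inverse `uinv t`),
and the invertible map `A` (with inverse `Ainv`) commutes with every `v t`
in the sense `v t ∘ A⁻¹ = A⁻¹ ∘ v t`, then `t ↦ u t⁻¹ ∘ A⁻¹ ∘ u t` is constant. -/
theorem uhlenbeck_trick_invariance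
    {V : Type*} [NormedAddCommGroup V] [NormedSpace ℝ V] [FiniteDimensional ℝ V]
    (v : ℝ → (V →L[ℝ] V)) (hv : Continuous v)
    (u uinv : ℝ → (V →L[ℝ] V))
    (huinv_left : ∀ t, (uinv t).comp (u t) = ContinuousLinearMap.id ℝ V)
    (huinv_right : ∀ t, (u t).comp (uinv t) = ContinuousLinearMap.id ℝ V)
    (hu : ∀ t, HasDerivAt u (-(1/2 : ℝ) • ((v t).comp (u t))) t)
    (A Ainv : V →L[ℝ] V)
    (hA_left : Ainv.comp A = ContinuousLinearMap.id ℝ V)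
    (hA_right : A.comp Ainv = ContinuousLinearMap.id ℝ V)
    (hcomm : ∀ t, (v t).comp Ainv = Ainv.comp (v t)) :
    ∀ s t : ℝ, (uinv t).comp (Ainv.comp (u t)) = (uinv s).comp (Ainv.comp (u s)) := by
  have : CompleteSpace V := FiniteDimensional.complete ℝ V
  exact conj_eq_of_hasDerivAt_smul_mul (-(1 / 2 : ℝ)) huinv_left huinv_right hu hcomm
end

section
/- Let n be a positive integer and T > 0. Let g, v : [0,T] → Matrix n n ℝ be continuous with each g(t) symmetric positive definite and each v(t) symmetric, and suppose g is differentiable with g'(t) = v(t) for all t ∈ [0,T]. Let u : [0,T] → Matrix n n ℝ be differentiable with u(t) invertible for all t and satisfying the ODE u'(t) = -(1/2) · g(t)⁻¹ · v(t) · u(t). Then the matrix u(t)ᵀ · g(t) · u(t) is constant in t; in particular u(t)ᵀ g(t) u(t) = u(0)ᵀ g(0) u(0) for all t ∈ [0,T]. -/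
open Set Matrix

/-- Product rule for matrix products, stated entrywise. -/
theorem hasDerivWithinAt_matrix_mul_apply {l m n : Type*} [Fintype m]
    {A : ℝ → Matrix l m ℝ} {B : ℝ → Matrix m n ℝ} {A' : Matrix l m ℝ} {B' : Matrix m n ℝ}
    {s : Set ℝ} {t : ℝ}
    (hA : ∀ i j, HasDerivWithinAt (fun x => A x i j) (A' i j) s t)
    (hB : ∀ i j, HasDerivWithinAt (fun x => B x i j) (B' i j) s t) (i : l) (j : n) :
    HasDerivWithinAt (fun x => (A x * B x) i j) ((A' * B t + A t * B') i j) s t := by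
  simp only [Matrix.add_apply, Matrix.mul_apply, ← Finset.sum_add_distrib]
  exact HasDerivWithinAt.fun_sum fun k _ => (hA i k).fun_mul (hB k j)

/-- The derivative of `uᵀ * g * u` vanishes when `g' = v` and `u' = -(1/2) • (g⁻¹ * v * u)`. -/
theorem uhlenbeck_deriv_eq_zero {n : Type*} [Fintype n] [DecidableEq n]
    {g v u : Matrix n n ℝ} (hg : g.IsSymm) (hdet : IsUnit g.det) (hv : v.IsSymm) :
    ((-(1 / 2 : ℝ) • (g⁻¹ * v * u))ᵀ * g + uᵀ * v) * u
      + uᵀ * g * (-(1 / 2 : ℝ) • (g⁻¹ * v * u)) = 0 := by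
  have h₁ : (g⁻¹ * v * u)ᵀ * g = uᵀ * v := by
    rw [transpose_mul, transpose_mul, transpose_nonsing_inv, hg.eq, hv.eq, Matrix.mul_assoc,
      Matrix.mul_assoc, nonsing_inv_mul _ hdet, Matrix.mul_one]
  have h₂ : uᵀ * g * (g⁻¹ * v * u) = uᵀ * v * u := by
    simp only [Matrix.mul_assoc, mul_nonsing_inv_cancel_left _ _ hdet]
  rw [transpose_smul, Matrix.smul_mul, h₁, Matrix.mul_smul, h₂, Matrix.add_mul, Matrix.smul_mul]
  module

/-- Matrix form of the Uhlenbeck trick: if `g' = v` with `g t` symmetric positive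
definite and `v t` symmetric, and the invertible matrices `u t` solve
`u' = -(1/2) • (g⁻¹ * v * u)`, then `uᵀ * g * u` is constant in `t`. -/
theorem uhlenbeck_trick_matrix
    {n : ℕ} (hn : 0 < n) {T : ℝ} (hT : 0 < T)
    (g v u : ℝ → Matrix (Fin n) (Fin n) ℝ)
    (hg_cont : ∀ i j, ContinuousOn (fun t => g t i j) (Icc 0 T))
    (hv_cont : ∀ i j, ContinuousOn (fun t => v t i j) (Icc 0 T))
    (hg_posdef : ∀ t ∈ Icc (0:ℝ) T, (g t).PosDef)
    (hv_symm : ∀ t ∈ Icc (0:ℝ) T, (v t).IsSymm)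
    (hg_deriv : ∀ t ∈ Icc (0:ℝ) T, ∀ i j,
      HasDerivWithinAt (fun s => g s i j) (v t i j) (Icc 0 T) t)
    (hu_unit : ∀ t ∈ Icc (0:ℝ) T, IsUnit (u t))
    (hu_deriv : ∀ t ∈ Icc (0:ℝ) T, ∀ i j,
      HasDerivWithinAt (fun s => u s i j)
        ((-(1/2 : ℝ) • ((g t)⁻¹ * v t * u t)) i j) (Icc 0 T) t) :
    ∀ t ∈ Icc (0:ℝ) T, (u t)ᵀ * g t * u t = (u 0)ᵀ * g 0 * u 0 := by
  have hderiv : ∀ t ∈ Icc (0 : ℝ) T, ∀ i j,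
      HasDerivWithinAt (fun s => ((u s)ᵀ * g s * u s) i j) 0 (Icc 0 T) t := by
    intro t ht i j
    have h := hasDerivWithinAt_matrix_mul_apply
      (hasDerivWithinAt_matrix_mul_apply (A := fun s => (u s)ᵀ)
        (A' := (-(1 / 2 : ℝ) • ((g t)⁻¹ * v t * u t))ᵀ)
        (fun i j => hu_deriv t ht j i) (hg_deriv t ht))
      (hu_deriv t ht) i j
    have hsymm : (g t).IsSymm :=
      (conjTranspose_eq_transpose_of_trivial (g t)).symm.trans (hg_posdef t ht).isHermitian
    rwa [uhlenbeck_deriv_eq_zero hsymm (hg_posdef t ht).det_pos.ne'.isUnit (hv_symm t ht)] at h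
  intro t ht
  ext i j
  exact constant_of_derivWithin_zero (fun s hs => (hderiv s hs i j).differentiableWithinAt)
    (fun s hs => (hderiv s (Ico_subset_Icc_self hs) i j).derivWithin
      (uniqueDiffOn_Icc hT s (Ico_subset_Icc_self hs))) t ht
end
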